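/- arXiv:1807.10113 — 2 statements merged into one kernel-verified Lean document; each statement's English description precedes it below -/
import Mathlib

section
/- For every real number c > 0 there exists a positive integer m = m(c) such that the following holds. If G is a finite group containing a product-free subset of size at least c·|G|, then G has a non-perfect subgroup H of index at most m, i.e. a subgroup H with [H, H] ≠ H. -/
open Pointwise

/-- A subset `A` of a group is product-free if there are no `x, y, z ∈ A` with `x * y = z`. -/
def ProductFree {G : Type*} [Group G] (A : Set G) : Prop :=
  ∀ x ∈ A, ∀ y ∈ A, x * y ∉ A

open scoped Matrix

theorem commutator_ne_top_of_monoidHom {G M : Type*} [Group G] [CommMonoid M] (f : G →* M)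
    {g : G} (hg : f g ≠ 1) : commutator G ≠ ⊤ := by
  intro h
  have hk := Abelianization.commutator_subset_ker f.toHomUnits
  rw [h] at hk
  have := MonoidHom.mem_ker.1 (hk (Subgroup.mem_top g))
  exact hg (by simpa using congrArg Units.val this)

theorem Complex.one_le_mul_norm_one_sub_of_pow_eq_one {z : ℂ} {k : ℕ} (hk : 0 < k)
    (hz : z ≠ 1) (hzk : z ^ k = 1) : 1 ≤ k * ‖1 - z‖ := by
  have hn : ‖z‖ = 1 := Complex.norm_eq_one_of_pow_eq_one hzk hk.ne'
  have hpow (i : ℕ) : ‖1 - z ^ i‖ ≤ i * ‖1 - z‖ := by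
    rw [← mul_neg_geom_sum, norm_mul, mul_comm]
    gcongr
    refine (norm_sum_le _ _).trans ?_
    simp [hn]
  have hgeom : ∑ i ∈ Finset.range k, z ^ i = 0 := by
    have := mul_neg_geom_sum z k
    rw [hzk, sub_self] at this
    exact (mul_eq_zero.1 this).resolve_left (sub_ne_zero.2 hz.symm)
  have hsum : ∑ i ∈ Finset.range k, (1 - z ^ i) = k := by
    rw [Finset.sum_sub_distrib, hgeom]; simp
  have h1 : (k : ℝ) ≤ k * (k * ‖1 - z‖) := by
    calc (k : ℝ) = ‖(k : ℂ)‖ := by simp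
      _ = ‖∑ i ∈ Finset.range k, (1 - z ^ i)‖ := by rw [hsum]
      _ ≤ ∑ i ∈ Finset.range k, ‖1 - z ^ i‖ := norm_sum_le _ _
      _ ≤ ∑ i ∈ Finset.range k, (k : ℝ) * ‖1 - z‖ := by
        refine Finset.sum_le_sum fun i hi => (hpow i).trans ?_
        have := (Finset.mem_range.1 hi).le
        gcongr
      _ = k * (k * ‖1 - z‖) := by simp
  have hk' : (0 : ℝ) < k := by exact_mod_cast hk
  exact le_of_mul_le_mul_left (by simpa using h1) hk'

section
variable {E : Type*} [NormedAddCommGroup E] [NormedSpace ℂ E]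

theorem norm_map_commutator_sub_one_le {G : Type*} [Group G] {φ : G →* (E →L[ℂ] E)}
    (hφ : ∀ g x, ‖φ g x‖ = ‖x‖) (z h : G) :
    ‖φ (z * h * (h * z)⁻¹) - 1‖ ≤ 2 * ‖φ z - 1‖ * ‖φ h - 1‖ := by
  have hn (g : G) : ‖φ g‖ ≤ 1 :=
    ContinuousLinearMap.opNorm_le_bound _ zero_le_one fun x => by rw [hφ, one_mul]
  have heq : φ (z * h * (h * z)⁻¹) - 1 =
      ((φ z - 1) * (φ h - 1) - (φ h - 1) * (φ z - 1)) * φ (h * z)⁻¹ := by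
    have h1 : (φ z - 1) * (φ h - 1) - (φ h - 1) * (φ z - 1) = φ (z * h) - φ (h * z) := by
      simp only [map_mul]; noncomm_ring
    rw [h1, sub_mul, ← map_mul, ← map_mul, mul_inv_cancel, map_one]
  rw [heq]
  calc _ ≤ ‖(φ z - 1) * (φ h - 1) - (φ h - 1) * (φ z - 1)‖ * ‖φ (h * z)⁻¹‖ := norm_mul_le _ _
    _ ≤ ‖(φ z - 1) * (φ h - 1) - (φ h - 1) * (φ z - 1)‖ * 1 := by gcongr; exact hn _
    _ ≤ ‖(φ z - 1) * (φ h - 1)‖ + ‖(φ h - 1) * (φ z - 1)‖ := by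
      rw [mul_one]; exact norm_sub_le _ _
    _ ≤ ‖φ z - 1‖ * ‖φ h - 1‖ + ‖φ h - 1‖ * ‖φ z - 1‖ := by gcongr <;> exact norm_mul_le _ _
    _ = _ := by ring

variable [FiniteDimensional ℂ E]

theorem exists_eigenvector_ne_one {T : E →ₗ[ℂ] E} (h1 : T ≠ 1)
    (hT : IsOfFinOrder T) : ∃ μ : ℂ, μ ≠ 1 ∧ Module.End.HasEigenvalue T μ := by
  obtain ⟨n, hn, hTn⟩ := isOfFinOrder_iff_pow_eq_one.1 hT
  have hR : LinearMap.range (T - 1) ≠ ⊥ := by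
    rw [Ne, LinearMap.range_eq_bot, sub_eq_zero]; exact h1
  have hinv : ∀ x ∈ LinearMap.range (T - 1), T x ∈ LinearMap.range (T - 1) := by
    rintro _ ⟨v, rfl⟩
    exact ⟨T v, by simp⟩
  have : Nontrivial (LinearMap.range (T - 1)) := Submodule.nontrivial_iff_ne_bot.2 hR
  obtain ⟨μ, hμ⟩ := Module.End.exists_eigenvalue (T.restrict hinv)
  obtain ⟨⟨w, hw⟩, hwe⟩ := hμ.exists_hasEigenvector
  have hTw : T w = μ • w := by
    simpa [Subtype.ext_iff] using hwe.apply_eq_smul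
  have hw0 : w ≠ 0 := fun h => hwe.2 (Subtype.ext h)
  refine ⟨μ, ?_, Module.End.hasEigenvalue_of_hasEigenvector
    (Module.End.hasEigenvector_iff.2 ⟨Module.End.mem_eigenspace_iff.2 hTw, hw0⟩)⟩
  rintro rfl
  obtain ⟨v, hv⟩ := hw
  have hk (k : ℕ) : (T ^ k) v = v + k • w := by
    induction k with
    | zero => simp
    | succ k ih =>
      rw [pow_succ', Module.End.mul_apply, ih, map_add, map_nsmul, hTw, one_smul, succ_nsmul,
        ← hv]
      simp only [LinearMap.sub_apply, Module.End.one_apply]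
      abel
  have := hk n
  rw [hTn] at this
  have h0 : n • w = 0 := by simpa using this
  rw [← Nat.cast_smul_eq_nsmul ℂ] at h0
  exact hw0 ((smul_eq_zero.1 h0).resolve_left (by exact_mod_cast hn.ne'))

theorem commutator_ne_top_of_commute {H : Type*} [Group H] [Finite H] (φ : H →* (E →L[ℂ] E))
    {z : H} (hz : φ z ≠ 1) (hcomm : ∀ h, Commute (φ z) (φ h))
    (hsmall : Module.finrank ℂ E * ‖φ z - 1‖ < 1) : commutator H ≠ ⊤ := by
  let ψ : H →* (E →ₗ[ℂ] E) :=
    (ContinuousLinearMap.toLinearMapRingHom : _ →+* (E →ₗ[ℂ] E)).toMonoidHom.comp φ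
  have hψ (h : H) (x : E) : ψ h x = φ h x := rfl
  have hψz : ψ z ≠ 1 := fun h => hz (ContinuousLinearMap.ext fun x => by
    rw [← hψ, h]; rfl)
  obtain ⟨μ, hμ1, hμ⟩ := exists_eigenvector_ne_one hψz (ψ.isOfFinOrder (isOfFinOrder_of_finite z))
  set U := Module.End.eigenspace (ψ z) μ with hU
  have hinv (h : H) : ∀ x ∈ U, ψ h x ∈ U := by
    intro x hx
    rw [hU, Module.End.mem_eigenspace_iff] at hx ⊢
    rw [← map_smul, ← hx]
    exact congrArg (fun T : E →L[ℂ] E => T x) (hcomm h).eq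
  let θ : H →* (U →ₗ[ℂ] U) :=
    { toFun := fun h => (ψ h).restrict (hinv h)
      map_one' := by ext; simp
      map_mul' := fun a b => by ext; simp }
  have hθz : θ z = μ • 1 := by
    ext ⟨x, hx⟩
    exact Module.End.mem_eigenspace_iff.1 hx
  refine commutator_ne_top_of_monoidHom ((LinearMap.det : (U →ₗ[ℂ] U) →* ℂ).comp θ) (g := z) ?_
  rw [MonoidHom.comp_apply, hθz, LinearMap.det_smul, map_one, mul_one]
  intro hdet
  obtain ⟨w, hw⟩ := hμ.exists_hasEigenvector
  have hUpos : 0 < Module.finrank ℂ U := by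
    have : Nontrivial U := Submodule.nontrivial_iff_ne_bot.2 hμ
    exact Module.finrank_pos
  have h1 := Complex.one_le_mul_norm_one_sub_of_pow_eq_one hUpos hμ1 hdet
  have h2 : ‖1 - μ‖ ≤ ‖φ z - 1‖ := by
    have h3 := (φ z - 1).le_opNorm w
    have h4 : (φ z - 1) w = (μ - 1) • w := by
      rw [sub_smul, one_smul, ← hw.apply_eq_smul]; rfl
    rw [h4, norm_smul, norm_sub_rev] at h3
    exact le_of_mul_le_mul_right h3 (norm_pos_iff.2 hw.2)
  have h5 : (Module.finrank ℂ U : ℝ) ≤ Module.finrank ℂ E := by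
    exact_mod_cast Submodule.finrank_le U
  have : (Module.finrank ℂ U : ℝ) * ‖1 - μ‖ ≤ Module.finrank ℂ E * ‖φ z - 1‖ := by gcongr
  linarith

variable (E) in
/-- The elements close to the identity generate a subgroup of bounded index. -/
theorem exists_index_closure_le {ε : ℝ} (hε : 0 < ε) :
    ∃ m : ℕ, ∀ (G : Type*) [Group G] (φ : G →* (E →L[ℂ] E)), (∀ g x, ‖φ g x‖ = ‖x‖) →
      (Subgroup.closure {g | ‖φ g - 1‖ < ε}).index ≤ m := by
  have : ProperSpace (E →L[ℂ] E) := FiniteDimensional.proper ℂ _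
  obtain ⟨t, -, htfin, ht⟩ := finite_cover_balls_of_compact
    (isCompact_closedBall (0 : E →L[ℂ] E) 1) (half_pos hε)
  refine ⟨t.ncard, fun G _ φ hφ => ?_⟩
  have hn (g : G) : ‖φ g‖ ≤ 1 :=
    ContinuousLinearMap.opNorm_le_bound _ zero_le_one fun x => by rw [hφ, one_mul]
  have hmem (g : G) : ∃ c ∈ t, dist (φ g) c < ε / 2 := by
    simpa using ht (mem_closedBall_zero_iff.2 (hn g))
  choose c hct hc using hmem
  set H := Subgroup.closure {g | ‖φ g - 1‖ < ε}
  have : Finite t := htfin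
  let F : G ⧸ H → t := fun q => ⟨c q.out, hct _⟩
  have hF : Function.Injective F := by
    intro q q' h
    have h1 : c q.out = c q'.out := congrArg Subtype.val h
    rw [← q.out_eq', ← q'.out_eq']
    refine QuotientGroup.eq.2 (Subgroup.subset_closure ?_)
    have h2 : dist (φ q'.out) (φ q.out) < ε := by
      have := dist_triangle_right (φ q'.out) (φ q.out) (c q.out)
      have := hc q.out
      have := hc q'.out
      rw [← h1] at this
      linarith
    have h3 : φ (q.out⁻¹ * q'.out) - 1 = φ q.out⁻¹ * (φ q'.out - φ q.out) := by
      rw [mul_sub, ← map_mul, ← map_mul, inv_mul_cancel, map_one]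
    rw [Set.mem_ofPred_eq, h3]
    calc _ ≤ ‖φ q.out⁻¹‖ * ‖φ q'.out - φ q.out‖ := norm_mul_le _ _
      _ ≤ 1 * ‖φ q'.out - φ q.out‖ := by gcongr; exact hn _
      _ < ε := by rwa [one_mul, ← dist_eq_norm]
  simpa [Subgroup.index, Set.ncard] using Nat.card_le_card_of_injective F hF

variable (E) in
theorem exists_index_le_commutator_ne_top_aux :
    ∃ m : ℕ, ∀ (G : Type*) [Group G] [Finite G] (φ : G →* (E →L[ℂ] E)),
      (∀ g x, ‖φ g x‖ = ‖x‖) → (∃ g, φ g ≠ 1) →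
        ∃ H : Subgroup G, H.index ≤ m ∧ commutator H ≠ ⊤ := by
  set d := Module.finrank ℂ E
  have hd : (0 : ℝ) ≤ d := d.cast_nonneg
  have hε : (0 : ℝ) < 1 / (d + 2) := by positivity
  obtain ⟨m, hm⟩ := exists_index_closure_le E hε
  refine ⟨m, fun G _ _ φ hφ hne => ?_⟩
  specialize hm G φ hφ
  set S : Set G := {g | ‖φ g - 1‖ < 1 / ((d : ℝ) + 2)} with hS
  by_cases hcase : ∃ g ∈ S, φ g ≠ 1
  · refine ⟨_, hm, ?_⟩
    obtain ⟨g₀, hg₀S, hg₀⟩ := hcase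
    obtain ⟨z, hz, hmin⟩ := Set.exists_min_image {g | φ g ≠ 1} (fun g => ‖φ g - 1‖)
      (Set.toFinite _) ⟨g₀, hg₀⟩
    have hzS : ‖φ z - 1‖ < 1 / ((d : ℝ) + 2) := (hmin g₀ hg₀).trans_lt hg₀S
    have hzpos : 0 < ‖φ z - 1‖ := norm_pos_iff.2 (sub_ne_zero.2 hz)
    have hcommS : ∀ h ∈ S, Commute (φ z) (φ h) := by
      intro h hh
      have h1 : φ (z * h * (h * z)⁻¹) = 1 := by
        by_contra hne1
        have h2 := hmin _ hne1
        have h3 := norm_map_commutator_sub_one_le hφ z h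
        have h4 : ‖φ h - 1‖ < 1 / 2 :=
          lt_of_lt_of_le hh (one_div_le_one_div_of_le two_pos (by linarith))
        nlinarith
      have h2 : φ (z * h) = φ (h * z) := by
        rw [← inv_mul_cancel_right (z * h) (h * z), map_mul, h1, one_mul]
      simpa [Commute, SemiconjBy] using h2
    have hcomm : ∀ h : Subgroup.closure S, Commute (φ z) (φ h) := by
      rintro ⟨h, hh⟩
      induction hh using Subgroup.closure_induction with
      | mem x hx => exact hcommS x hx
      | one => simp
      | mul x y _ _ hx hy => simpa using hx.mul_right hy
      | inv x _ hx =>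
        have hu : (φ.toHomUnits x : E →L[ℂ] E) = φ x := rfl
        have := Commute.units_inv_right (u := φ.toHomUnits x) hx
        rwa [← map_inv] at this
    refine commutator_ne_top_of_commute (φ.comp (Subgroup.closure S).subtype)
      (z := ⟨z, Subgroup.subset_closure hzS⟩) hz hcomm ?_
    change (d : ℝ) * ‖φ z - 1‖ < 1
    rw [lt_div_iff₀ (by positivity)] at hzS
    nlinarith
  · push Not at hcase
    obtain ⟨g, hg⟩ := hne
    let φ' := φ.toHomUnits
    let _ : CommGroup (Subgroup.zpowers (φ' g)) :=
      { (inferInstance : Group (Subgroup.zpowers (φ' g))) with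
        mul_comm := IsMulCommutative.is_comm.comm }
    refine ⟨(Subgroup.zpowers (φ' g)).comap φ', (Subgroup.index_antitone ?_).trans hm,
      commutator_ne_top_of_monoidHom (φ'.subgroupComap (Subgroup.zpowers (φ' g)))
        (g := ⟨g, Subgroup.mem_zpowers _⟩) ?_⟩
    · rw [Subgroup.closure_le]
      intro s hs
      have : φ' s = 1 := Units.ext (hcase s hs)
      simp [this, one_mem]
    · intro h
      exact hg (congrArg (fun u => ((u : (E →L[ℂ] E)ˣ) : E →L[ℂ] E)) (congrArg Subtype.val h))

end

theorem exists_index_le_commutator_ne_top (d : ℕ) :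
    ∃ m : ℕ, ∀ (G V : Type) [Group G] [Finite G] [NormedAddCommGroup V] [InnerProductSpace ℂ V]
      [FiniteDimensional ℂ V] (φ : G →* (V →L[ℂ] V)), Module.finrank ℂ V = d →
      (∀ g x, ‖φ g x‖ = ‖x‖) → (∃ g, φ g ≠ 1) →
        ∃ H : Subgroup G, H.index ≤ m ∧ commutator H ≠ ⊤ := by
  obtain ⟨m, hm⟩ := exists_index_le_commutator_ne_top_aux (EuclideanSpace ℂ (Fin d))
  refine ⟨m, fun G V _ _ _ _ _ φ hd hφ hne => ?_⟩
  have : CompleteSpace V := FiniteDimensional.complete ℂ V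
  let e : V ≃ₗᵢ[ℂ] EuclideanSpace ℂ (Fin d) :=
    ((stdOrthonormalBasis ℂ V).reindex (finCongr hd)).repr
  refine hm G ((e.conjStarAlgEquiv : _ →* _).comp φ) (fun g x => ?_) ?_
  · simp [hφ]
  · obtain ⟨g, hg⟩ := hne
    exact ⟨g, fun h => hg (e.conjStarAlgEquiv.injective (h.trans (map_one _).symm))⟩

theorem Matrix.exists_hasEigenvalue_conjTranspose_mul_self {ι : Type*} [Fintype ι] [DecidableEq ι]
    (M : Matrix ι ι ℂ) {f : EuclideanSpace ℂ ι} (hf : f ≠ 0) :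
    ∃ r : ℝ, ‖M.toEuclideanLin f‖ ^ 2 ≤ r * ‖f‖ ^ 2 ∧
      Module.End.HasEigenvalue (Mᴴ * M).toEuclideanLin (r : ℂ) ∧
      Module.finrank ℂ (Module.End.eigenspace (Mᴴ * M).toEuclideanLin (r : ℂ)) * r ≤
        ∑ x, ∑ y, ‖M x y‖ ^ 2 := by
  set T := M.toEuclideanLin with hT
  set S := (Mᴴ * M).toEuclideanLin with hS
  have hSapp (v : EuclideanSpace ℂ ι) : S v = LinearMap.adjoint T (T v) := by
    rw [hS, hT, ← Matrix.toEuclideanLin_conjTranspose_eq_adjoint]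
    exact congrArg (fun L => L v) (Matrix.toLpLin_mul_same 2 Mᴴ M)
  have hre (v : EuclideanSpace ℂ ι) : RCLike.re (inner ℂ (S v) v) = ‖T v‖ ^ 2 := by
    rw [hSapp, LinearMap.adjoint_inner_left, inner_self_eq_norm_sq]
  have hsymm : S.IsSymmetric := fun u v => by
    rw [hSapp, hSapp, LinearMap.adjoint_inner_left, LinearMap.adjoint_inner_right]
  have : Nontrivial (EuclideanSpace ℂ ι) := ⟨f, 0, hf⟩
  have heig := hsymm.hasEigenvalue_iSup_of_finiteDimensional
  set r := ⨆ x : {x : EuclideanSpace ℂ ι // x ≠ 0},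
    RCLike.re (inner ℂ (S x) (x : EuclideanSpace ℂ ι)) / ‖(x : EuclideanSpace ℂ ι)‖ ^ 2
  refine ⟨r, ?_, heig, ?_⟩
  · have hbdd : BddAbove (Set.range fun x : {x : EuclideanSpace ℂ ι // x ≠ 0} =>
        RCLike.re (inner ℂ (S x) (x : EuclideanSpace ℂ ι)) / ‖(x : EuclideanSpace ℂ ι)‖ ^ 2) := by
      refine ⟨‖LinearMap.toContinuousLinearMap T‖ ^ 2, ?_⟩
      rintro _ ⟨⟨x, hx⟩, rfl⟩
      have hx' := norm_pos_iff.2 hx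
      simp only [hre]
      rw [div_le_iff₀ (by positivity), ← mul_pow]
      exact pow_le_pow_left₀ (norm_nonneg _) ((LinearMap.toContinuousLinearMap T).le_opNorm x) 2
    have hf' := norm_pos_iff.2 hf
    have : RCLike.re (inner ℂ (S f) f) / ‖f‖ ^ 2 ≤ r := le_ciSup hbdd ⟨f, hf⟩
    rwa [hre, div_le_iff₀ (by positivity)] at this
  · set V := Module.End.eigenspace S (r : ℂ) with hV
    let b := stdOrthonormalBasis ℂ V
    have hb : Orthonormal ℂ (fun i => (b i : EuclideanSpace ℂ ι)) :=
      b.orthonormal.comp_linearIsometry V.subtypeₗᵢ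
    have hbT (i) : ‖T (b i)‖ ^ 2 = r := by
      rw [← hre, Module.End.mem_eigenspace_iff.1 (b i).2, inner_smul_left,
        inner_self_eq_norm_sq_to_K, hb.norm_eq_one]
      simp
    have hrow (x : ι) (v : EuclideanSpace ℂ ι) :
        ‖T v x‖ = ‖inner ℂ v (WithLp.toLp 2 (star (M x)))‖ := by
      rw [← norm_inner_symm]
      congr 1
      simp [hT, Matrix.toLpLin_apply, PiLp.inner_apply, Matrix.mulVec, dotProduct, mul_comm]
    calc (Module.finrank ℂ V : ℝ) * r = ∑ i, ‖T (b i)‖ ^ 2 := by simp [hbT]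
      _ = ∑ x, ∑ i, ‖inner ℂ (b i : EuclideanSpace ℂ ι) (WithLp.toLp 2 (star (M x)))‖ ^ 2 := by
        rw [Finset.sum_comm]
        refine Finset.sum_congr rfl fun i _ => ?_
        rw [EuclideanSpace.norm_sq_eq]
        exact Finset.sum_congr rfl fun x _ => by rw [hrow]
      _ ≤ ∑ x, ‖(WithLp.toLp 2 (star (M x)) : EuclideanSpace ℂ ι)‖ ^ 2 :=
        Finset.sum_le_sum fun x _ => hb.sum_inner_products_le _
      _ = _ := by simp [EuclideanSpace.norm_sq_eq]

/-- The right regular representation. -/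
noncomputable def rightRegular (G : Type*) [Group G] [Fintype G] :
    G →* (EuclideanSpace ℂ G →ₗ[ℂ] EuclideanSpace ℂ G) where
  toFun g :=
    { toFun := fun f => WithLp.toLp 2 fun x => f (x * g)
      map_add' := fun _ _ => rfl
      map_smul' := fun _ _ => rfl }
  map_one' := by ext; simp
  map_mul' a b := by
    refine LinearMap.ext fun f => PiLp.ext fun x => ?_
    change f (x * (a * b)) = f (x * a * b)
    rw [mul_assoc]

theorem rightRegular_apply {G : Type*} [Group G] [Fintype G] (g : G) (f : EuclideanSpace ℂ G)
    (x : G) : rightRegular G g f x = f (x * g) := rfl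

theorem norm_rightRegular {G : Type*} [Group G] [Fintype G] (g : G) (f : EuclideanSpace ℂ G) :
    ‖rightRegular G g f‖ = ‖f‖ := by
  rw [← sq_eq_sq₀ (norm_nonneg _) (norm_nonneg _), EuclideanSpace.norm_sq_eq,
    EuclideanSpace.norm_sq_eq]
  exact Equiv.sum_comp (Equiv.mulRight g) fun x => ‖f x‖ ^ 2

theorem toEuclideanLin_rightRegular {G : Type*} [Group G] [Fintype G] [DecidableEq G]
    {N : Matrix G G ℂ} (hN : ∀ x y g, N (x * g) (y * g) = N x y) (g : G)
    (f : EuclideanSpace ℂ G) :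
    N.toEuclideanLin (rightRegular G g f) = rightRegular G g (N.toEuclideanLin f) := by
  refine PiLp.ext fun x => ?_
  simp only [rightRegular_apply, Matrix.toLpLin_apply, Matrix.mulVec, dotProduct]
  rw [← Equiv.sum_comp (Equiv.mulRight g) fun y => N (x * g) y * f y]
  simp [hN]

theorem sum_indicator_one_eq_ncard {ι R : Type*} [Fintype ι] [Semiring R] (A : Set ι) :
    ∑ x, A.indicator (1 : ι → R) x = A.ncard := by
  classical
  simp [Set.indicator_apply, Set.ncard_eq_toFinset_card', Finset.sum_boole]

theorem norm_sq_toLp_indicator_one {ι : Type*} [Fintype ι] (A : Set ι) :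
    ‖(WithLp.toLp 2 (A.indicator 1) : EuclideanSpace ℂ ι)‖ ^ 2 = A.ncard := by
  rw [EuclideanSpace.norm_sq_eq, ← sum_indicator_one_eq_ncard]
  refine Finset.sum_congr rfl fun x _ => ?_
  by_cases h : x ∈ A <;> simp [h]

/-- The balanced convolution kernel of a subset of a finite group. -/
noncomputable def balancedKernel {G : Type*} [Group G] [Fintype G] (A : Set G) : Matrix G G ℂ :=
  fun x y => A.indicator 1 (x * y⁻¹) - (A.ncard / Fintype.card G : ℂ)

section
variable {G : Type*} [Group G] [Fintype G] (A : Set G)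

theorem balancedKernel_mul_right (x y g : G) :
    balancedKernel A (x * g) (y * g) = balancedKernel A x y := by
  simp [balancedKernel, mul_assoc]

theorem sum_balancedKernel (x : G) : ∑ y, balancedKernel A x y = 0 := by
  have h : ∑ y, A.indicator (1 : G → ℂ) (x * y⁻¹) = A.ncard := by
    rw [← sum_indicator_one_eq_ncard,
      ← Equiv.sum_comp ((Equiv.inv G).trans (Equiv.mulLeft x)) (A.indicator (1 : G → ℂ))]
    rfl
  have hn : (Fintype.card G : ℂ) ≠ 0 := by exact_mod_cast Fintype.card_ne_zero
  simp only [balancedKernel, Finset.sum_sub_distrib, h]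
  simp
  field_simp
  simp

theorem sum_norm_sq_balancedKernel_le :
    ∑ x, ∑ y, ‖balancedKernel A x y‖ ^ 2 ≤ (Fintype.card G : ℝ) * A.ncard := by
  have hn : (0 : ℝ) < Fintype.card G := by exact_mod_cast Fintype.card_pos
  set α : ℝ := A.ncard / Fintype.card G with hα
  have hk (x y : G) : ‖balancedKernel A x y‖ ^ 2 =
      (1 - 2 * α) * A.indicator 1 (x * y⁻¹) + α ^ 2 := by
    have : balancedKernel A x y = ((A.indicator 1 (x * y⁻¹) - α : ℝ) : ℂ) := by
      by_cases h : x * y⁻¹ ∈ A <;> simp [balancedKernel, h, hα]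
    rw [this, Complex.norm_real, Real.norm_eq_abs, sq_abs]
    by_cases h : x * y⁻¹ ∈ A
    · simp only [h, Set.indicator_of_mem, Pi.one_apply]; ring
    · simp [h]
  have h (x : G) : ∑ y, A.indicator (1 : G → ℝ) (x * y⁻¹) = A.ncard := by
    rw [← sum_indicator_one_eq_ncard,
      ← Equiv.sum_comp ((Equiv.inv G).trans (Equiv.mulLeft x)) (A.indicator (1 : G → ℝ))]
    rfl
  have hA : (A.ncard : ℝ) = α * Fintype.card G := by rw [hα]; field_simp
  simp only [hk, Finset.sum_add_distrib, ← Finset.mul_sum, h]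
  simp only [Finset.sum_const, Finset.card_univ, nsmul_eq_mul, hA]
  have : 0 ≤ (Fintype.card G : ℝ) ^ 2 * α ^ 2 := by positivity
  nlinarith

variable {A}

theorem ProductFree.toEuclideanLin_balancedKernel_apply [DecidableEq G] (hA : ProductFree A)
    {x : G} (hx : x ∈ A) :
    (balancedKernel A).toEuclideanLin (WithLp.toLp 2 (A.indicator 1)) x =
      -((A.ncard : ℂ) ^ 2 / Fintype.card G) := by
  have h (y : G) : balancedKernel A x y * A.indicator 1 y =
      -(A.ncard / Fintype.card G : ℂ) * A.indicator 1 y := by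
    by_cases hy : y ∈ A
    · have : x * y⁻¹ ∉ A := fun h => hA _ h _ hy (by simpa using hx)
      simp [balancedKernel, hy, this]
    · simp [hy]
  simp only [Matrix.toLpLin_apply, Matrix.mulVec, dotProduct, h]
  rw [← Finset.mul_sum, sum_indicator_one_eq_ncard]
  ring

theorem ProductFree.le_norm_sq_toEuclideanLin_balancedKernel [DecidableEq G]
    (hA : ProductFree A) :
    (A.ncard : ℝ) ^ 5 / Fintype.card G ^ 2 ≤
      ‖(balancedKernel A).toEuclideanLin (WithLp.toLp 2 (A.indicator 1))‖ ^ 2 := by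
  rw [EuclideanSpace.norm_sq_eq]
  calc (A.ncard : ℝ) ^ 5 / Fintype.card G ^ 2
      = ∑ x, ((A.ncard : ℝ) ^ 2 / Fintype.card G) ^ 2 * A.indicator 1 x := by
        rw [← Finset.mul_sum, sum_indicator_one_eq_ncard]; ring
    _ ≤ _ := by
        refine Finset.sum_le_sum fun x _ => ?_
        by_cases hx : x ∈ A
        · rw [hA.toEuclideanLin_balancedKernel_apply hx]
          simp [hx]
        · simp [hx]

/-- A group with a dense product-free subset has a nontrivial unitary representation of small
dimension. -/
theorem ProductFree.exists_representation (hA : ProductFree A) (hne : A.Nonempty) :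
    ∃ (V : Submodule ℂ (EuclideanSpace ℂ G)) (φ : G →* (V →L[ℂ] V)),
      (∀ g x, ‖φ g x‖ = ‖x‖) ∧ (∃ g, φ g ≠ 1) ∧
        (Module.finrank ℂ V : ℝ) * A.ncard ^ 3 ≤ Fintype.card G ^ 3 := by
  classical
  have hn : (0 : ℝ) < Fintype.card G := by exact_mod_cast Fintype.card_pos
  have ha : (0 : ℝ) < A.ncard := by exact_mod_cast hne.ncard_pos
  set M := balancedKernel A with hM
  have hf := norm_sq_toLp_indicator_one A
  set f : EuclideanSpace ℂ G := WithLp.toLp 2 (A.indicator 1)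
  have hf0 : f ≠ 0 := by
    rintro h
    rw [h, norm_zero] at hf
    simp only [ne_eq, OfNat.ofNat_ne_zero, not_false_eq_true, zero_pow] at hf
    exact ha.ne hf
  obtain ⟨r, hr, heig, hdim⟩ := M.exists_hasEigenvalue_conjTranspose_mul_self hf0
  have hr' : (A.ncard : ℝ) ^ 4 ≤ r * Fintype.card G ^ 2 := by
    have := hA.le_norm_sq_toEuclideanLin_balancedKernel.trans hr
    rw [hf, div_le_iff₀ (by positivity)] at this
    refine le_of_mul_le_mul_right ?_ ha
    linarith
  have hr0 : 0 < r := by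
    by_contra! h
    have : r * (Fintype.card G : ℝ) ^ 2 ≤ 0 := mul_nonpos_of_nonpos_of_nonneg h (by positivity)
    have : 0 < (A.ncard : ℝ) ^ 4 := by positivity
    linarith
  have hMM (x y g : G) : (Mᴴ * M) (x * g) (y * g) = (Mᴴ * M) x y := by
    simp only [Matrix.mul_apply, Matrix.conjTranspose_apply]
    rw [← Equiv.sum_comp (Equiv.mulRight g)]
    simp [hM, balancedKernel_mul_right]
  set V := Module.End.eigenspace (Mᴴ * M).toEuclideanLin (r : ℂ)
  have hinv (g : G) : ∀ v ∈ V, rightRegular G g v ∈ V := by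
    intro v hv
    rw [Module.End.mem_eigenspace_iff] at hv ⊢
    rw [toEuclideanLin_rightRegular hMM, hv, map_smul]
  let φ : G →* (V →L[ℂ] V) :=
    { toFun := fun g => LinearMap.toContinuousLinearMap ((rightRegular G g).restrict (hinv g))
      map_one' := by ext; simp
      map_mul' := fun a b => by ext; simp }
  refine ⟨V, φ, fun g x => norm_rightRegular g x, ?_, ?_⟩
  · by_contra! htriv
    obtain ⟨v, hv⟩ := heig.exists_hasEigenvector
    have hconst (x : G) : v x = v 1 := by
      have h1 : φ x ⟨v, hv.1⟩ = ⟨v, hv.1⟩ := by rw [htriv]; rfl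
      have h2 : rightRegular G x v = v := congrArg Subtype.val h1
      have h3 := rightRegular_apply x v 1
      rwa [h2, one_mul, eq_comm] at h3
    have hMv : M *ᵥ v = 0 := by
      ext x
      simp only [Matrix.mulVec, dotProduct, hconst]
      rw [← Finset.sum_mul, sum_balancedKernel]
      simp
    have h0 : (Mᴴ * M).toEuclideanLin v = 0 := by
      rw [Matrix.toLpLin_apply, ← Matrix.mulVec_mulVec, hMv]
      simp
    rw [hv.apply_eq_smul, smul_eq_zero] at h0
    exact h0.elim (by exact_mod_cast hr0.ne') hv.2
  · have h1 := hdim.trans (sum_norm_sq_balancedKernel_le A)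
    refine le_of_mul_le_mul_right ?_ ha
    calc (Module.finrank ℂ V : ℝ) * A.ncard ^ 3 * A.ncard
        = Module.finrank ℂ V * A.ncard ^ 4 := by ring
      _ ≤ Module.finrank ℂ V * (r * Fintype.card G ^ 2) := by gcongr
      _ = Module.finrank ℂ V * r * Fintype.card G ^ 2 := by ring
      _ ≤ Fintype.card G * A.ncard * Fintype.card G ^ 2 := by gcongr
      _ = _ := by ring

end

theorem exists_index_le_commutator_ne_top_of_finrank_le (D : ℕ) :
    ∃ m : ℕ, ∀ (G V : Type) [Group G] [Finite G] [NormedAddCommGroup V] [InnerProductSpace ℂ V]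
      [FiniteDimensional ℂ V] (φ : G →* (V →L[ℂ] V)), Module.finrank ℂ V ≤ D →
      (∀ g x, ‖φ g x‖ = ‖x‖) → (∃ g, φ g ≠ 1) →
        ∃ H : Subgroup G, H.index ≤ m ∧ commutator H ≠ ⊤ := by
  choose m hm using exists_index_le_commutator_ne_top
  refine ⟨∑ d ∈ Finset.range (D + 1), m d, fun G V _ _ _ _ _ φ hd hφ hφne => ?_⟩
  obtain ⟨H, hH, hHne⟩ := hm _ G V φ rfl hφ hφne
  exact ⟨H, hH.trans (Finset.single_le_sum (fun _ _ => Nat.zero_le _)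
    (Finset.mem_range_succ_iff.2 hd)), hHne⟩

theorem ProductFree.exists_index_le_commutator_ne_top (D : ℕ) :
    ∃ m : ℕ, ∀ (G : Type) [Group G] [Fintype G] (A : Set G), ProductFree A → A.Nonempty →
      (Fintype.card G : ℝ) ^ 3 ≤ D * (A.ncard : ℝ) ^ 3 →
        ∃ H : Subgroup G, H.index ≤ m ∧ commutator H ≠ ⊤ := by
  obtain ⟨m, hm⟩ := exists_index_le_commutator_ne_top_of_finrank_le D
  refine ⟨m, fun G _ _ A hA hne hD => ?_⟩
  obtain ⟨V, φ, hφ, hφne, hdim⟩ := hA.exists_representation hne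
  have ha : (0 : ℝ) < A.ncard := by exact_mod_cast hne.ncard_pos
  have hdD : Module.finrank ℂ V ≤ D :=
    Nat.cast_le.1 (le_of_mul_le_mul_right (hdim.trans hD) (pow_pos ha 3))
  exact hm G V φ hdD hφ hφne

theorem stmt_8 (c : ℝ) (hc : 0 < c) :
    ∃ m : ℕ, 0 < m ∧
      ∀ (G : Type) [Group G] [Fintype G] (A : Set G),
        ProductFree A → c * (Fintype.card G : ℝ) ≤ (A.ncard : ℝ) →
        ∃ H : Subgroup G, H.index ≤ m ∧ commutator ↥H ≠ ⊤ := by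
  obtain ⟨D, hD⟩ := exists_nat_ge (c ^ 3)⁻¹
  obtain ⟨m, hm⟩ := ProductFree.exists_index_le_commutator_ne_top D
  refine ⟨m + 1, m.succ_pos, fun G _ _ A hA hcA => ?_⟩
  have hn : (0 : ℝ) < Fintype.card G := by exact_mod_cast Fintype.card_pos
  have ha : (0 : ℝ) < A.ncard := (mul_pos hc hn).trans_le hcA
  have hne : A.Nonempty := (Set.ncard_pos (Set.toFinite A)).1 (by exact_mod_cast ha)
  have hcard : (Fintype.card G : ℝ) ^ 3 ≤ D * (A.ncard : ℝ) ^ 3 :=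
    calc (Fintype.card G : ℝ) ^ 3 = (c ^ 3)⁻¹ * (c * Fintype.card G) ^ 3 := by field_simp
      _ ≤ D * (A.ncard : ℝ) ^ 3 := by gcongr
  obtain ⟨H, hH, hHne⟩ := hm G A hA hne hcard
  exact ⟨H, hH.trans m.le_succ, hHne⟩
end

section
/- For every real number c > 0 there exists a positive integer N = N(c) such that every finite simple non-abelian group G containing a product-free subset of size at least c·|G| satisfies |G| ≤ N. In other words, there are only finitely many finite simple non-abelian groups containing a product-free set of proportional size at least c. -/
open Pointwise

open Module

section SimpleGroups

variable {G : Type*} [Group G]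

lemma MonoidHom.injective_of_isSimpleGroup {M : Type*} [Monoid M] [IsSimpleGroup G] (ρ : G →* M)
    (hρ : ∃ g, ρ g ≠ 1) : Function.Injective ρ := by
  obtain ⟨g, hg⟩ := hρ
  have hker : ρ.ker = ⊥ :=
    (IsSimpleGroup.eq_bot_or_eq_top_of_normal ρ.ker inferInstance).resolve_right fun h ↦
      hg (MonoidHom.mem_ker.1 (h ▸ Subgroup.mem_top g))
  intro a b hab
  have : a * b⁻¹ ∈ ρ.ker := by
    rw [MonoidHom.mem_ker, map_mul, hab, ← map_mul, mul_inv_cancel, map_one]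
  rw [hker, Subgroup.mem_bot] at this
  exact mul_inv_eq_one.1 this

/-- In a simple group, an element which commutes with all of its conjugates is trivial, unless the
group is commutative. -/
lemma IsSimpleGroup.eq_one_of_commute_conj [IsSimpleGroup G] (hG : ¬ ∀ a b : G, a * b = b * a)
    (g : G) (hg : ∀ x : G, Commute g (x * g * x⁻¹)) : g = 1 := by
  by_contra hne
  have hconj : ∀ a ∈ Group.conjugatesOfSet {g}, ∀ b ∈ Group.conjugatesOfSet {g},
      a * b = b * a := by
    intro a ha b hb
    simp only [Group.mem_conjugatesOfSet_iff, Set.mem_singleton_iff, exists_eq_left,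
      isConj_iff] at ha hb
    obtain ⟨x, rfl⟩ := ha
    obtain ⟨y, rfl⟩ := hb
    have h := (hg (x⁻¹ * y)).map (MulAut.conj x)
    simp only [MulAut.conj_apply] at h
    convert h.eq using 1 <;> group
  have htop : Subgroup.normalClosure {g} = ⊤ :=
    (IsSimpleGroup.eq_bot_or_eq_top_of_normal _ Subgroup.normalClosure_normal).resolve_left
      fun h ↦ hne (by
        have : g ∈ Subgroup.normalClosure {g} :=
          Subgroup.subset_normalClosure (Set.mem_singleton g)
        rwa [h, Subgroup.mem_bot] at this)
  refine hG fun a b ↦ ?_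
  have hmem (x : G) : x ∈ Subgroup.closure (Group.conjugatesOfSet {g}) :=
    htop.ge (Subgroup.mem_top x)
  have := Subgroup.isMulCommutative_closure hconj
  exact congrArg Subtype.val
    (this.is_comm.comm (⟨a, hmem a⟩ : Subgroup.closure _) ⟨b, hmem b⟩)

section NormedRing

variable {R : Type*} [NormedRing R] (ρ : G →* R) (hρ : ∀ g, ‖ρ g‖ ≤ 1)
include hρ

lemma norm_mul_map_le (r : R) (g : G) : ‖r * ρ g‖ ≤ ‖r‖ :=
  (norm_mul_le _ _).trans (mul_le_of_le_one_right (norm_nonneg _) (hρ g))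

lemma norm_map_mul_le (r : R) (g : G) : ‖ρ g * r‖ ≤ ‖r‖ :=
  (norm_mul_le _ _).trans (mul_le_of_le_one_left (norm_nonneg _) (hρ g))

lemma norm_map_commutator_sub_one_le_s9 (g h : G) :
    ‖ρ (g * h * g⁻¹ * h⁻¹) - 1‖ ≤ 2 * ‖ρ g - 1‖ * ‖ρ h - 1‖ := by
  have h1 : ρ (g * h * g⁻¹ * h⁻¹) - 1
      = ((ρ g - 1) * (ρ h - 1) - (ρ h - 1) * (ρ g - 1)) * ρ (g⁻¹ * h⁻¹) := by
    have h2 : (1 : R) = ρ h * ρ g * ρ (g⁻¹ * h⁻¹) := by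
      rw [← map_mul, ← map_mul, ← map_one ρ]
      congr 1
      group
    have h3 : ρ (g * h * g⁻¹ * h⁻¹) = ρ g * ρ h * ρ (g⁻¹ * h⁻¹) := by
      rw [← map_mul, ← map_mul]
      congr 1
      group
    rw [h3]
    nth_rewrite 1 [h2]
    noncomm_ring
  rw [h1]
  refine (norm_mul_map_le ρ hρ _ _).trans ((norm_sub_le _ _).trans ?_)
  linarith [norm_mul_le (ρ g - 1) (ρ h - 1), norm_mul_le (ρ h - 1) (ρ g - 1)]

lemma norm_map_conj_sub_one_le (g x : G) : ‖ρ (x * g * x⁻¹) - 1‖ ≤ ‖ρ g - 1‖ := by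
  have h1 : ρ (x * g * x⁻¹) - 1 = ρ x * (ρ g - 1) * ρ x⁻¹ := by
    rw [mul_sub, sub_mul, mul_one, ← map_mul, ← map_mul, ← map_mul, mul_inv_cancel, map_one]
  rw [h1]
  exact (norm_mul_map_le ρ hρ _ _).trans (norm_map_mul_le ρ hρ _ _)

lemma half_le_norm_map_sub_one [Finite G] [IsSimpleGroup G] (hG : ¬ ∀ a b : G, a * b = b * a)
    (hinj : Function.Injective ρ) {g : G} (hg : g ≠ 1) : 1 / 2 ≤ ‖ρ g - 1‖ := by
  obtain ⟨m, hm, hmin⟩ := Set.exists_min_image {g : G | g ≠ 1} (fun g ↦ ‖ρ g - 1‖)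
    (Set.toFinite _) ⟨g, hg⟩
  refine le_trans ?_ (hmin g hg)
  by_contra! hlt
  refine hm (IsSimpleGroup.eq_one_of_commute_conj hG m fun x ↦ ?_)
  set y := x * m * x⁻¹ with hy
  have hpos : 0 < ‖ρ m - 1‖ :=
    norm_pos_iff.2 (sub_ne_zero.2 fun h ↦ hm (hinj (h.trans (map_one ρ).symm)))
  have h1 := norm_map_commutator_sub_one_le_s9 ρ hρ m y
  have h2 : ‖ρ y - 1‖ ≤ ‖ρ m - 1‖ := norm_map_conj_sub_one_le ρ hρ m x
  by_contra hcomm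
  have h3 : m * y * m⁻¹ * y⁻¹ ≠ 1 := fun h ↦ hcomm (by
    rw [mul_inv_eq_one, mul_inv_eq_iff_eq_mul] at h
    exact h)
  have h4 := hmin _ h3
  nlinarith

/-- A finite simple non-abelian group embedded in the unit ball of a finite-dimensional normed
algebra has order bounded in terms of the dimension. -/
lemma card_le_five_pow_finrank [NormedAlgebra ℝ R] [FiniteDimensional ℝ R] [Finite G]
    [IsSimpleGroup G] (hG : ¬ ∀ a b : G, a * b = b * a) (hinj : Function.Injective ρ) :
    Nat.card G ≤ 5 ^ finrank ℝ R := by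
  classical
  have := Fintype.ofFinite G
  have hinj2 : Function.Injective fun g ↦ (2 : ℝ) • ρ g :=
    (smul_right_injective R two_ne_zero).comp hinj
  have h := Besicovitch.card_le_of_separated (E := R)
    (Finset.univ.image fun g ↦ (2 : ℝ) • ρ g) ?_ ?_
  · rwa [Finset.card_image_of_injective _ hinj2, Finset.card_univ, ← Nat.card_eq_fintype_card] at h
  · simp only [Finset.mem_image, Finset.mem_univ, true_and, forall_exists_index,
      forall_apply_eq_imp_iff]
    intro g
    rw [norm_smul, Real.norm_ofNat]
    linarith [hρ g]
  · simp only [Finset.mem_image, Finset.mem_univ, true_and, forall_exists_index,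
      forall_apply_eq_imp_iff]
    intro a b hab
    have hne : a * b⁻¹ ≠ 1 := fun h ↦ hab (by rw [mul_inv_eq_one.1 h])
    have h1 := half_le_norm_map_sub_one ρ hρ hG hinj hne
    have h2 : ρ (a * b⁻¹) - 1 = (ρ a - ρ b) * ρ b⁻¹ := by
      rw [sub_mul, ← map_mul, ← map_mul, mul_inv_cancel, map_one]
    have h3 := norm_mul_map_le ρ hρ (ρ a - ρ b) b⁻¹
    rw [← smul_sub, norm_smul, Real.norm_ofNat]
    rw [h2] at h1
    linarith

end NormedRing

/-- A finite simple non-abelian group acting isometrically and non-trivially on an invariant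
finite-dimensional space has order bounded in terms of the dimension. -/
lemma card_le_of_invariant_submodule [Finite G] [IsSimpleGroup G]
    (hG : ¬ ∀ a b : G, a * b = b * a) {E : Type*} [NormedAddCommGroup E] [NormedSpace ℝ E]
    (ρ : G →* (E →ₗ[ℝ] E)) (hρ : ∀ g v, ‖ρ g v‖ = ‖v‖) (V : Submodule ℝ E) [FiniteDimensional ℝ V]
    (hV : ∀ g, ∀ v ∈ V, ρ g v ∈ V) (hne : ∃ g, ∃ v ∈ V, ρ g v ≠ v) :
    Nat.card G ≤ 5 ^ (finrank ℝ V ^ 2) := by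
  let σ : G →* (V →L[ℝ] V) :=
    { toFun := fun g ↦ LinearMap.toContinuousLinearMap ((ρ g).restrict (hV g))
      map_one' := by ext v; simp
      map_mul' := fun a b ↦ by ext v; simp }
  have hσ (g : G) (v : V) : (σ g v : E) = ρ g v := rfl
  have hle (g : G) : ‖σ g‖ ≤ 1 := by
    refine ContinuousLinearMap.opNorm_le_bound (σ g) zero_le_one fun v ↦ ?_
    rw [one_mul, ← Submodule.norm_coe, hσ, hρ, Submodule.norm_coe]
  have hinj : Function.Injective σ := by
    obtain ⟨g, v, hv, hgv⟩ := hne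
    refine σ.injective_of_isSimpleGroup ⟨g, fun h ↦ hgv ?_⟩
    rw [← hσ g ⟨v, hv⟩, h]
    rfl
  have h := card_le_five_pow_finrank (R := V →L[ℝ] V) σ hle hG hinj
  rwa [← (LinearMap.toContinuousLinearMap (𝕜 := ℝ) (E := V) (F' := V)).finrank_eq,
    Module.finrank_linearMap, ← sq] at h

end SimpleGroups

section Singular

open scoped InnerProductSpace

variable {E : Type*} [NormedAddCommGroup E] [InnerProductSpace ℝ E] [FiniteDimensional ℝ E]

lemma LinearMap.exists_hasEigenvalue_mul_adjoint [Nontrivial E] (T : E →ₗ[ℝ] E) :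
    ∃ μ : ℝ, End.HasEigenvalue (T * T.adjoint) μ ∧ ∀ v, ‖T.adjoint v‖ ^ 2 ≤ μ * ‖v‖ ^ 2 := by
  have hinner (v : E) : ⟪(T * T.adjoint) v, v⟫_ℝ = ‖T.adjoint v‖ ^ 2 := by
    rw [Module.End.mul_apply, ← LinearMap.adjoint_inner_right, real_inner_self_eq_norm_sq]
  have hsymm : (T * T.adjoint).IsSymmetric := fun v w ↦ by
    rw [Module.End.mul_apply, Module.End.mul_apply, ← LinearMap.adjoint_inner_left,
      ← LinearMap.adjoint_inner_right]
  refine ⟨_, hsymm.hasEigenvalue_iSup_of_finiteDimensional, fun v ↦ ?_⟩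
  rcases eq_or_ne v 0 with rfl | hv
  · simp
  have hpos : 0 < ‖v‖ ^ 2 := by positivity
  rw [← div_le_iff₀ hpos, ← hinner]
  refine le_ciSup (f := fun x : {x : E // x ≠ 0} ↦
    RCLike.re ⟪(T * T.adjoint) x, x⟫_ℝ / ‖(x : E)‖ ^ 2) ⟨‖T.adjoint.toContinuousLinearMap‖ ^ 2, ?_⟩
    ⟨v, hv⟩
  rintro _ ⟨⟨w, hw⟩, rfl⟩
  have hw' : 0 < ‖w‖ ^ 2 := by positivity
  simp only [RCLike.re_to_real]
  rw [hinner, div_le_iff₀ hw', ← mul_pow]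
  exact pow_le_pow_left₀ (norm_nonneg _) (T.adjoint.toContinuousLinearMap.le_opNorm w) 2

lemma LinearMap.finrank_eigenspace_mul_le {ι : Type*} [Fintype ι] (T : E →ₗ[ℝ] E) (μ : ℝ)
    (e : OrthonormalBasis ι ℝ E) :
    finrank ℝ (End.eigenspace (T * T.adjoint) μ) * μ ≤ ∑ i, ‖T (e i)‖ ^ 2 := by
  set V := End.eigenspace (T * T.adjoint) μ
  let b := stdOrthonormalBasis ℝ V
  have hb : Orthonormal ℝ fun i ↦ (b i : E) := b.orthonormal.comp_linearIsometry V.subtypeₗᵢ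
  have hnorm i : ‖T.adjoint (b i)‖ ^ 2 = μ := by
    rw [← real_inner_self_eq_norm_sq, LinearMap.adjoint_inner_right, ← Module.End.mul_apply,
      End.mem_eigenspace_iff.1 (b i).2, real_inner_smul_left, real_inner_self_eq_norm_sq,
      hb.1 i]
    simp
  calc finrank ℝ V * μ = ∑ i, ‖T.adjoint (b i)‖ ^ 2 := by simp [hnorm]
    _ = ∑ i, ∑ j, ‖⟪(b i : E), T (e j)⟫_ℝ‖ ^ 2 := by
      refine Finset.sum_congr rfl fun i _ ↦ ?_
      rw [← e.sum_sq_norm_inner_left]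
      simp [LinearMap.adjoint_inner_left]
    _ = ∑ j, ∑ i, ‖⟪(b i : E), T (e j)⟫_ℝ‖ ^ 2 := Finset.sum_comm
    _ ≤ ∑ j, ‖T (e j)‖ ^ 2 := Finset.sum_le_sum fun j _ ↦ hb.sum_inner_products_le _

end Singular

section Convolution

variable {G : Type*} [Group G]

/-- The right regular representation on real-valued functions. -/
noncomputable def rightTranslation : G →* (EuclideanSpace ℝ G →ₗ[ℝ] EuclideanSpace ℝ G) where
  toFun g :=
    { toFun := fun f ↦ WithLp.toLp 2 fun x ↦ f (x * g)
      map_add' := fun _ _ ↦ rfl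
      map_smul' := fun _ _ ↦ rfl }
  map_one' := by ext f x; simp
  map_mul' a b := by
    ext f x
    exact congrArg f (mul_assoc x a b).symm

@[simp]
lemma rightTranslation_apply (g : G) (f : EuclideanSpace ℝ G) (x : G) :
    rightTranslation g f x = f (x * g) := rfl

variable [Fintype G]

lemma norm_rightTranslation (g : G) (f : EuclideanSpace ℝ G) :
    ‖rightTranslation g f‖ = ‖f‖ := by
  simp only [EuclideanSpace.norm_eq, rightTranslation_apply]
  rw [← Equiv.sum_comp (Equiv.mulRight g) fun x ↦ ‖f x‖ ^ 2]
  rfl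

variable [DecidableEq G]

/-- Left convolution by a function on a finite group. -/
noncomputable def leftConvolution (φ : G → ℝ) : EuclideanSpace ℝ G →ₗ[ℝ] EuclideanSpace ℝ G :=
  Matrix.toEuclideanLin (Matrix.of fun z x ↦ φ (z * x⁻¹))

lemma leftConvolution_apply (φ : G → ℝ) (f : EuclideanSpace ℝ G) (z : G) :
    leftConvolution φ f z = ∑ x, φ (z * x⁻¹) * f x := rfl

lemma adjoint_leftConvolution_apply (φ : G → ℝ) (f : EuclideanSpace ℝ G) (x : G) :
    (leftConvolution φ).adjoint f x = ∑ z, φ (z * x⁻¹) * f z := by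
  rw [leftConvolution, ← Matrix.toEuclideanLin_conjTranspose_eq_adjoint]
  rfl

lemma leftConvolution_rightTranslation (φ : G → ℝ) (g : G) (f : EuclideanSpace ℝ G) :
    leftConvolution φ (rightTranslation g f) = rightTranslation g (leftConvolution φ f) := by
  ext z
  simp only [leftConvolution_apply, rightTranslation_apply]
  rw [← Equiv.sum_comp (Equiv.mulRight g) fun x ↦ φ (z * g * x⁻¹) * f x]
  simp [mul_assoc]

lemma adjoint_leftConvolution_rightTranslation (φ : G → ℝ) (g : G) (f : EuclideanSpace ℝ G) :
    (leftConvolution φ).adjoint (rightTranslation g f)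
      = rightTranslation g ((leftConvolution φ).adjoint f) := by
  ext z
  simp only [adjoint_leftConvolution_apply, rightTranslation_apply]
  rw [← Equiv.sum_comp (Equiv.mulRight g) fun x ↦ φ (x * (z * g)⁻¹) * f x]
  simp [mul_assoc]

lemma sum_leftConvolution (φ : G → ℝ) (f : EuclideanSpace ℝ G) :
    ∑ z, leftConvolution φ f z = (∑ x, φ x) * ∑ x, f x := by
  simp only [leftConvolution_apply]
  rw [Finset.sum_comm, Finset.mul_sum]
  refine Finset.sum_congr rfl fun x _ ↦ ?_
  rw [← Finset.sum_mul, ← Equiv.sum_comp (Equiv.mulRight x⁻¹) φ]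
  rfl

lemma norm_leftConvolution_basisFun (φ : G → ℝ) (x : G) :
    ‖leftConvolution φ (EuclideanSpace.basisFun G ℝ x)‖ ^ 2 = ∑ y, φ y ^ 2 := by
  simp only [EuclideanSpace.norm_sq_eq, leftConvolution_apply]
  rw [← Equiv.sum_comp (Equiv.mulRight x⁻¹) fun y ↦ φ y ^ 2]
  simp [EuclideanSpace.basisFun_apply, PiLp.single_apply]

/-- A mean-zero function which convolves with large norm gives rise to a low-dimensional
non-trivial representation, and hence bounds the order of a simple group. -/
lemma exists_dimension_bound [IsSimpleGroup G] (hG : ¬ ∀ a b : G, a * b = b * a) (φ : G → ℝ)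
    (hφ : ∑ x, φ x = 0) (f : EuclideanSpace ℝ G) (hf : (leftConvolution φ).adjoint f ≠ 0) :
    ∃ m : ℕ, Fintype.card G ≤ 5 ^ (m ^ 2) ∧
      m * ‖(leftConvolution φ).adjoint f‖ ^ 2
        ≤ Fintype.card G * (∑ x, φ x ^ 2) * ‖f‖ ^ 2 := by
  set T := leftConvolution φ
  obtain ⟨μ, hμ, hle⟩ := T.exists_hasEigenvalue_mul_adjoint
  set V := End.eigenspace (T * T.adjoint) μ with hVdef
  have hμ0 : μ ≠ 0 := by
    rintro rfl
    have := hle f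
    rw [zero_mul] at this
    exact hf (norm_eq_zero.1 (pow_eq_zero_iff two_ne_zero |>.1 (le_antisymm this (sq_nonneg _))))
  refine ⟨finrank ℝ V, ?_, ?_⟩
  · rw [← Nat.card_eq_fintype_card]
    refine card_le_of_invariant_submodule hG rightTranslation norm_rightTranslation V ?_ ?_
    · intro g v hv
      rw [hVdef, End.mem_eigenspace_iff, Module.End.mul_apply] at hv ⊢
      rw [adjoint_leftConvolution_rightTranslation, leftConvolution_rightTranslation, hv, map_smul]
    · obtain ⟨v, hv, hv0⟩ := hμ.exists_hasEigenvector
      by_contra! hfix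
      have hconst (x : G) : v x = v 1 := by
        have h := rightTranslation_apply x v 1
        rwa [hfix x v hv, one_mul, eq_comm] at h
      have hsum : ∑ x, v x = 0 := by
        have h1 : ∑ x, (T (T.adjoint v)) x = 0 := by rw [sum_leftConvolution, hφ, zero_mul]
        rw [← Module.End.mul_apply, End.mem_eigenspace_iff.1 hv] at h1
        simpa [← Finset.mul_sum, hμ0] using h1
      refine hv0 ?_
      ext x
      simpa [hconst] using hsum
  · have h1 := T.finrank_eigenspace_mul_le μ (EuclideanSpace.basisFun G ℝ)
    simp only [T, norm_leftConvolution_basisFun, Finset.sum_const, Finset.card_univ,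
      nsmul_eq_mul] at h1
    calc (finrank ℝ V : ℝ) * ‖T.adjoint f‖ ^ 2 ≤ finrank ℝ V * (μ * ‖f‖ ^ 2) := by
          gcongr; exact hle f
      _ = finrank ℝ V * μ * ‖f‖ ^ 2 := by ring
      _ ≤ _ := by gcongr

end Convolution

theorem stmt_9 (c : ℝ) (hc : 0 < c) :
    ∃ N : ℕ, 0 < N ∧
      ∀ (G : Type) [Group G] [Fintype G],
        IsSimpleGroup G → (¬ ∀ a b : G, a * b = b * a) →
        ∀ A : Set G, ProductFree A → c * (Fintype.card G : ℝ) ≤ (A.ncard : ℝ) →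
        Fintype.card G ≤ N := by
  refine ⟨5 ^ (⌊1 / c ^ 3⌋₊ ^ 2), by positivity, fun G _ _ _ hG A hA hcA ↦ ?_⟩
  classical
  obtain ⟨s, rfl⟩ : ∃ s : Finset G, (s : Set G) = A := ⟨A.toFinset, by simp⟩
  rw [Set.ncard_coe_finset] at hcA
  have hn : (0 : ℝ) < Fintype.card G := by exact_mod_cast Fintype.card_pos
  have ha : (0 : ℝ) < s.card := (mul_pos hc hn).trans_le hcA
  set n : ℝ := (Fintype.card G : ℝ) with hn_def
  set a : ℝ := (s.card : ℝ) with ha_def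
  set φ : G → ℝ := fun x ↦ (if x ∈ s then 1 else 0) - a / n with hφ_def
  set f : EuclideanSpace ℝ G := WithLp.toLp 2 fun x ↦ if x ∈ s then 1 else 0 with hf_def
  have hφ : ∑ x, φ x = 0 := by
    simp [hφ_def, Finset.sum_sub_distrib, ← hn_def, ← ha_def]
    field_simp
    ring
  have hφ2 : ∑ x, φ x ^ 2 ≤ a := by
    have h1 : ∀ x, φ x ^ 2 = (1 - 2 * (a / n)) * (if x ∈ s then 1 else 0) + (a / n) ^ 2 := by
      intro x
      simp only [hφ_def]
      split_ifs <;> ring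
    simp only [h1, Finset.sum_add_distrib, ← Finset.mul_sum]
    simp [← hn_def, ← ha_def]
    have h2 : n * (a / n) ^ 2 = a * (a / n) := by field_simp
    have h3 : 0 ≤ a * (a / n) := by positivity
    linarith
  have hf : ‖f‖ ^ 2 = a := by
    simp [EuclideanSpace.norm_sq_eq, hf_def, ← ha_def]
  have hinner : inner ℝ ((leftConvolution φ).adjoint f) f = - (a / n * a ^ 2) := by
    have h1 : inner ℝ ((leftConvolution φ).adjoint f) f = ∑ x ∈ s, ∑ z ∈ s, φ (z * x⁻¹) := by
      simp [PiLp.inner_apply, adjoint_leftConvolution_apply, hf_def]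
    have h2 : ∀ x ∈ s, ∀ z ∈ s, φ (z * x⁻¹) = -(a / n) := by
      intro x hx z hz
      have : z * x⁻¹ ∉ s := fun h ↦ hA _ h x hx (by simpa using hz)
      simp [hφ_def, this]
    rw [h1, Finset.sum_congr rfl fun x hx ↦ Finset.sum_congr rfl (h2 x hx)]
    simp [← ha_def]
    ring
  have hcs := abs_real_inner_le_norm ((leftConvolution φ).adjoint f) f
  rw [hinner, abs_neg, abs_of_pos (by positivity)] at hcs
  have hne : (leftConvolution φ).adjoint f ≠ 0 := by
    intro h
    rw [h, norm_zero, zero_mul] at hcs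
    exact absurd hcs (not_le.2 (by positivity))
  obtain ⟨m, hm, hmle⟩ := exists_dimension_bound hG φ hφ f hne
  refine hm.trans (Nat.pow_le_pow_right (by norm_num) (Nat.pow_le_pow_left (Nat.le_floor ?_) 2))
  have hsq : (a / n * a ^ 2) ^ 2 ≤ ‖(leftConvolution φ).adjoint f‖ ^ 2 * a := by
    rw [← hf, ← mul_pow, hf]
    exact pow_le_pow_left₀ (by positivity) hcs 2
  have hfinal : m * (a / n) ^ 3 ≤ 1 := by
    have h1 : m * (a / n * a ^ 2) ^ 2 ≤ n * a * a * a := by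
      calc m * (a / n * a ^ 2) ^ 2 ≤ m * (‖(leftConvolution φ).adjoint f‖ ^ 2 * a) := by gcongr
        _ = m * ‖(leftConvolution φ).adjoint f‖ ^ 2 * a := by ring
        _ ≤ n * (∑ x, φ x ^ 2) * ‖f‖ ^ 2 * a := by gcongr
        _ ≤ n * a * a * a := by rw [hf]; gcongr
    have h2 : m * (a / n * a ^ 2) ^ 2 = m * (a / n) ^ 3 * (n * a * a * a) := by
      field_simp
    rw [h2] at h1
    exact le_of_mul_le_mul_right (by rwa [one_mul]) (by positivity)
  have hca : c ≤ a / n := (le_div_iff₀ hn).2 hcA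
  rw [le_div_iff₀ (by positivity)]
  exact le_trans (by gcongr) hfinal
end
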